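/- arXiv:1608.08927 — 5 statements merged into one kernel-verified Lean document; each statement's English description precedes it below -/
import Mathlib

section
/- Let T be a type and let G be a context-free grammar over T (in the sense of Mathlib's ContextFreeGrammar: a type of nonterminals, an initial nonterminal, and a finite list of production rules). If G is non-recursive — i.e., for every nonterminal A, no sentential form reachable from the one-symbol string [A] by one or more production steps contains the symbol A — then the language generated by G is a finite set of words over T. -/
namespace ContextFreeRule

variable {T N : Type*} {r : ContextFreeRule T N}

/-- A rewriting step on a concatenation takes place in one of the two factors. -/
lemma Rewrites.of_append {u v w : List (Symbol T N)} (h : r.Rewrites (u ++ v) w) :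
    (∃ u', r.Rewrites u u' ∧ w = u' ++ v) ∨ ∃ v', r.Rewrites v v' ∧ w = u ++ v' := by
  induction u generalizing w with
  | nil => exact Or.inr ⟨w, h, rfl⟩
  | cons x u ih =>
    cases h with
    | head s => exact Or.inl ⟨r.output ++ u, Rewrites.head u, by simp⟩
    | cons _ h =>
      rcases ih h with ⟨u', hu, rfl⟩ | ⟨v', hv, rfl⟩
      · exact Or.inl ⟨x :: u', Rewrites.cons x hu, rfl⟩
      · exact Or.inr ⟨v', hv, rfl⟩

end ContextFreeRule

namespace ContextFreeGrammar

variable {T : Type*} {G : ContextFreeGrammar T}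

/-- A derivation from a concatenation splits into derivations from the two factors. -/
lemma Derives.exists_of_append {u v w : List (Symbol T G.NT)} (h : G.Derives (u ++ v) w) :
    ∃ u' v', G.Derives u u' ∧ G.Derives v v' ∧ w = u' ++ v' := by
  induction h with
  | refl => exact ⟨u, v, .refl u, .refl v, rfl⟩
  | tail _ hstep ih =>
    obtain ⟨u', v', hu, hv, rfl⟩ := ih
    obtain ⟨r, hr, hrw⟩ := hstep
    rcases hrw.of_append with ⟨u'', hu', rfl⟩ | ⟨v'', hv', rfl⟩
    · exact ⟨u'', v', hu.trans_produces ⟨r, hr, hu'⟩, hv, rfl⟩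
    · exact ⟨u', v'', hu, hv.trans_produces ⟨r, hr, hv'⟩, rfl⟩

lemma produces_singleton_terminal {a : T} {w : List (Symbol T G.NT)} :
    ¬ G.Produces [Symbol.terminal a] w := by
  rintro ⟨r, -, h⟩
  simpa using h.nonterminal_input_mem

lemma Produces.exists_rule_of_singleton {A : G.NT} {w : List (Symbol T G.NT)}
    (h : G.Produces [Symbol.nonterminal A] w) : ∃ r ∈ G.rules, r.input = A ∧ w = r.output := by
  obtain ⟨r, hr, h⟩ := h
  cases h with
  | head => exact ⟨r, hr, rfl, by simp⟩
  | cons _ h => nomatch h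

lemma produces_of_mem_rules {r : ContextFreeRule T G.NT} (hr : r ∈ G.rules) :
    G.Produces [Symbol.nonterminal r.input] r.output :=
  ⟨r, hr, .input_output⟩

lemma finite_setOf_derives_of_forall_mem {u : List (Symbol T G.NT)}
    (h : ∀ x ∈ u, {w | G.Derives [x] w}.Finite) : {w | G.Derives u w}.Finite := by
  induction u with
  | nil =>
    refine (Set.finite_singleton []).subset fun w hw => ?_
    rcases hw.eq_or_head with rfl | ⟨v, hv, -⟩
    · rfl
    · obtain ⟨r, -, hr⟩ := hv.exists_nonterminal_input_mem
      simp at hr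
  | cons x u ih =>
    refine ((h x (by simp)).image2 (· ++ ·)
      (ih fun y hy => h y (List.mem_cons_of_mem x hy))).subset fun w hw => ?_
    obtain ⟨u', v', hu, hv, rfl⟩ := Derives.exists_of_append (u := [x]) (v := u) hw
    exact ⟨u', hu, v', hv, rfl⟩

/-- `G.Reaches A B` means that `B` occurs in some sentential form derived from `A`. -/
def Reaches (G : ContextFreeGrammar T) (A B : G.NT) : Prop :=
  ∃ u, G.Derives [Symbol.nonterminal A] u ∧ Symbol.nonterminal B ∈ u

lemma Reaches.refl (A : G.NT) : G.Reaches A A :=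
  ⟨_, .refl _, by simp⟩

lemma Reaches.exists_derives {u : List (Symbol T G.NT)} {A B : G.NT}
    (hA : Symbol.nonterminal A ∈ u) (h : G.Reaches A B) :
    ∃ w, G.Derives u w ∧ Symbol.nonterminal B ∈ w := by
  obtain ⟨p, q, rfl⟩ := List.append_of_mem hA
  obtain ⟨v, hv, hB⟩ := h
  refine ⟨p ++ (v ++ q), ?_, by simp [hB]⟩
  exact (hv.append_right q).append_left p

open Classical in
/-- The rules of `G` whose left-hand side is reachable from `A`. -/
noncomputable def reachableRules (G : ContextFreeGrammar T) (A : G.NT) :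
    Finset (ContextFreeRule T G.NT) :=
  G.rules.filter fun r => G.Reaches A r.input

lemma reachableRules_ssubset
    (hnr : ∀ A : G.NT, ∀ u : List (Symbol T G.NT),
      Relation.TransGen G.Produces [Symbol.nonterminal A] u → Symbol.nonterminal A ∉ u)
    {r : ContextFreeRule T G.NT} (hr : r ∈ G.rules) {B : G.NT}
    (hB : Symbol.nonterminal B ∈ r.output) :
    G.reachableRules B ⊂ G.reachableRules r.input := by
  classical
  have hp := produces_of_mem_rules hr
  refine Finset.ssubset_iff_of_subset (fun s hs => ?_) |>.2 ⟨r, ?_, fun h => ?_⟩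
  · obtain ⟨hs, hreach⟩ := Finset.mem_filter.1 hs
    obtain ⟨w, hw, hmem⟩ := hreach.exists_derives hB
    exact Finset.mem_filter.2 ⟨hs, w, hp.trans_derives hw, hmem⟩
  · exact Finset.mem_filter.2 ⟨hr, .refl _⟩
  · obtain ⟨w, hw, hmem⟩ := (Finset.mem_filter.1 h).2.exists_derives hB
    exact hnr _ w (.head' hp hw) hmem

lemma finite_setOf_derives_nonterminal
    (hnr : ∀ A : G.NT, ∀ u : List (Symbol T G.NT),
      Relation.TransGen G.Produces [Symbol.nonterminal A] u → Symbol.nonterminal A ∉ u)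
    (A : G.NT) : {w | G.Derives [Symbol.nonterminal A] w}.Finite := by
  induction hS : G.reachableRules A using Finset.strongInduction generalizing A with
  | H S ih =>
    subst hS
    have hfin : (⋃ r ∈ {r ∈ (G.rules : Set (ContextFreeRule T G.NT)) | r.input = A},
        {w | G.Derives r.output w}).Finite := by
      refine (G.rules.finite_toSet.subset (Set.sep_subset _ _)).biUnion ?_
      rintro r ⟨hr, rfl⟩
      refine finite_setOf_derives_of_forall_mem fun x hx => ?_
      cases x with
      | terminal a =>
        refine (Set.finite_singleton [Symbol.terminal a]).subset fun w hw => ?_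
        rcases Derives.eq_or_head hw with rfl | ⟨v, hv, -⟩
        · rfl
        · exact (produces_singleton_terminal hv).elim
      | nonterminal B => exact ih _ (reachableRules_ssubset hnr hr hx) B rfl
    refine (hfin.insert [Symbol.nonterminal A]).subset fun w hw => ?_
    rcases Derives.eq_or_head hw with rfl | ⟨v, hv, hvw⟩
    · exact Set.mem_insert _ _
    · obtain ⟨r, hr, hA, rfl⟩ := hv.exists_rule_of_singleton
      exact Set.mem_insert_of_mem _ (Set.mem_biUnion (show r ∈ {r | _} from ⟨hr, hA⟩) hvw)

end ContextFreeGrammar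

/-- If a context-free grammar `G` is non-recursive -- for every nonterminal `A`, no sentential
form reachable from `[Symbol.nonterminal A]` by one or more production steps contains
`Symbol.nonterminal A` -- then the language generated by `G` is finite. -/
theorem nonrecursive_language_finite {T : Type*} (G : ContextFreeGrammar T)
    (hnr : ∀ A : G.NT, ∀ u : List (Symbol T G.NT),
      Relation.TransGen G.Produces [Symbol.nonterminal A] u → Symbol.nonterminal A ∉ u) :
    (G.language : Set (List T)).Finite := by
  refine ((ContextFreeGrammar.finite_setOf_derives_nonterminal hnr G.initial).preimage
    (f := List.map Symbol.terminal) (Set.injOn_of_injective ?_)).subset fun w hw => hw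
  exact List.map_injective_iff.2 fun a b h => Symbol.terminal.inj h
end

section
/- Let G be a context-free grammar over a type T of terminals. If G is non-recursive — i.e., for every nonterminal A, no sentential form reachable from the one-symbol string [A] by one or more production steps contains the symbol A — then for every nonterminal A there exists a natural number d such that every chain of production steps u₀ = [Symbol.nonterminal A], G.Produces u₀ u₁, G.Produces u₁ u₂, …, G.Produces u_{n-1} u_n has length n ≤ d. (In particular, the maximal depth depth_G(A) over all parse trees rooted at A is well-defined.) -/
namespace ContextFreeGrammar

variable {T : Type*} (G : ContextFreeGrammar T)

/-- The left-hand sides of rules of `G` that occur in some sentential form derived from `A`. -/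
def reachableInputs (A : G.NT) : Set G.NT :=
  {C | (∃ r ∈ G.rules, r.input = C) ∧
    ∃ u, G.Derives [Symbol.nonterminal A] u ∧ Symbol.nonterminal C ∈ u}

lemma finite_reachableInputs (A : G.NT) : (G.reachableInputs A).Finite :=
  (G.rules.finite_toSet.image ContextFreeRule.input).subset fun _ hC => hC.1

variable {G}

lemma transGen_produces_of_mem_output {r : ContextFreeRule T G.NT} (hr : r ∈ G.rules) {B : G.NT}
    (hB : Symbol.nonterminal B ∈ r.output) {u : List (Symbol T G.NT)}
    (hu : G.Derives [Symbol.nonterminal B] u) :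
    ∃ p q, Relation.TransGen G.Produces [Symbol.nonterminal r.input] (p ++ u ++ q) := by
  obtain ⟨p, q, hpq⟩ := List.append_of_mem hB
  refine ⟨p, q, Relation.TransGen.head' ⟨r, hr, ContextFreeRule.Rewrites.input_output⟩ ?_⟩
  simpa [hpq] using (hu.append_left p).append_right q

lemma ncard_reachableInputs_lt
    (hnr : ∀ A : G.NT, ∀ u : List (Symbol T G.NT),
      Relation.TransGen G.Produces [Symbol.nonterminal A] u → Symbol.nonterminal A ∉ u)
    {r : ContextFreeRule T G.NT} (hr : r ∈ G.rules) {B : G.NT}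
    (hB : Symbol.nonterminal B ∈ r.output) :
    (G.reachableInputs B).ncard < (G.reachableInputs r.input).ncard := by
  refine Set.ncard_lt_ncard ?_ (G.finite_reachableInputs r.input)
  refine (Set.ssubset_iff_of_subset ?_).2 ⟨r.input, ?_, ?_⟩
  · rintro C ⟨hC, u, hu, hCu⟩
    obtain ⟨p, q, hpq⟩ := transGen_produces_of_mem_output hr hB hu
    exact ⟨hC, _, hpq.to_reflTransGen, by simp [hCu]⟩
  · exact ⟨⟨r, hr, rfl⟩, _, Derives.refl _, by simp⟩
  · rintro ⟨-, u, hu, hru⟩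
    obtain ⟨p, q, hpq⟩ := transGen_produces_of_mem_output hr hB hu
    exact hnr _ _ hpq (by simp [hru])

variable (G)

/-- The weight of a symbol: `0` for terminals, exponential in the number of reachable left-hand
sides for nonterminals, with a base exceeding the length of every right-hand side. -/
noncomputable def symbolWeight : Symbol T G.NT → ℕ
  | .terminal _ => 0
  | .nonterminal A =>
    (G.rules.sup (fun r => r.output.length) + 1) ^ (G.reachableInputs A).ncard

/-- The total weight of the symbols of a sentential form. -/
noncomputable def weight (u : List (Symbol T G.NT)) : ℕ :=
  (u.map G.symbolWeight).sum

variable {G}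

lemma weight_output_lt
    (hnr : ∀ A : G.NT, ∀ u : List (Symbol T G.NT),
      Relation.TransGen G.Produces [Symbol.nonterminal A] u → Symbol.nonterminal A ∉ u)
    {r : ContextFreeRule T G.NT} (hr : r ∈ G.rules) :
    G.weight r.output < G.symbolWeight (Symbol.nonterminal r.input) := by
  set L := G.rules.sup (fun r => r.output.length)
  set k := (G.reachableInputs r.input).ncard
  have hlen : r.output.length ≤ L := Finset.le_sup (f := fun r => r.output.length) hr
  have hpos : 0 < k :=
    (Set.ncard_pos (G.finite_reachableInputs _)).2
      ⟨r.input, ⟨r, hr, rfl⟩, _, Derives.refl _, by simp⟩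
  have hsymbol : ∀ n ∈ r.output.map G.symbolWeight, n ≤ (L + 1) ^ (k - 1) := by
    intro n hn
    obtain ⟨s, hs, rfl⟩ := List.mem_map.1 hn
    cases s with
    | terminal t => exact Nat.zero_le _
    | nonterminal B =>
      exact Nat.pow_le_pow_right L.succ_pos
        (Nat.le_sub_one_of_lt (ncard_reachableInputs_lt hnr hr hs))
  calc G.weight r.output
      ≤ r.output.length * (L + 1) ^ (k - 1) := by
        simpa [weight] using List.sum_le_card_nsmul _ _ hsymbol
    _ ≤ L * (L + 1) ^ (k - 1) := by gcongr
    _ < (L + 1) * (L + 1) ^ (k - 1) := by gcongr; exact L.lt_succ_self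
    _ = (L + 1) ^ k := mul_pow_sub_one hpos.ne' _

lemma Produces.weight_lt
    (hnr : ∀ A : G.NT, ∀ u : List (Symbol T G.NT),
      Relation.TransGen G.Produces [Symbol.nonterminal A] u → Symbol.nonterminal A ∉ u)
    {u v : List (Symbol T G.NT)} (huv : G.Produces u v) : G.weight v < G.weight u := by
  obtain ⟨r, hr, hrw⟩ := huv
  obtain ⟨p, q, rfl, rfl⟩ := hrw.exists_parts
  simpa [weight] using weight_output_lt hnr hr

end ContextFreeGrammar

/-- If a context-free grammar `G` is non-recursive, then for every nonterminal `A` there is a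
bound `d` on the length of any chain of production steps starting at `[Symbol.nonterminal A]`;
in particular the depth of `A` is well-defined. -/
theorem nonrecursive_depth_well_defined {T : Type*} (G : ContextFreeGrammar T)
    (hnr : ∀ A : G.NT, ∀ u : List (Symbol T G.NT),
      Relation.TransGen G.Produces [Symbol.nonterminal A] u → Symbol.nonterminal A ∉ u) :
    ∀ A : G.NT, ∃ d : ℕ, ∀ (n : ℕ) (c : Fin (n + 1) → List (Symbol T G.NT)),
      c 0 = [Symbol.nonterminal A] →
      (∀ j : Fin n, G.Produces (c j.castSucc) (c j.succ)) →
      n ≤ d := by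
  intro A
  refine ⟨G.weight [Symbol.nonterminal A], fun n c h0 hstep => ?_⟩
  have hbound : ∀ j : Fin (n + 1), G.weight (c j) + j ≤ G.weight (c 0) := by
    intro j
    induction j using Fin.induction with
    | zero => simp
    | succ j ih =>
      have hlt := (hstep j).weight_lt hnr
      simp only [Fin.val_castSucc, Fin.val_succ] at ih ⊢
      omega
  have hlast := hbound (Fin.last n)
  rw [h0, Fin.val_last] at hlast
  omega
end

section
/- Let G be a context-free grammar over a type T of terminals. If G is non-recursive — i.e., for every nonterminal A, no sentential form reachable from the one-symbol string [A] by one or more production steps contains the symbol A — then there is no sentential form u with Relation.TransGen G.Produces u u; that is, the one-step derivation relation of G admits no cycle on sentential forms. -/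
namespace ContextFreeGrammar

variable {T : Type*} {G : ContextFreeGrammar T}

/-- `G.Yields b a` means that the symbol `b` occurs in some sentential form reachable from the
one-symbol string `[a]` by at least one production step. -/
def Yields (G : ContextFreeGrammar T) (b a : Symbol T G.NT) : Prop :=
  ∃ v, Relation.TransGen G.Produces [a] v ∧ b ∈ v

lemma Yields.trans {a b c : Symbol T G.NT} (hcb : G.Yields c b) (hba : G.Yields b a) :
    G.Yields c a := by
  obtain ⟨w, hw, hc⟩ := hcb
  obtain ⟨v, hv, hb⟩ := hba
  obtain ⟨p, q, rfl⟩ := List.append_of_mem hb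
  have hpq : Relation.TransGen G.Produces (p ++ ([b] ++ q)) (p ++ (w ++ q)) :=
    Relation.TransGen.lift (fun x => p ++ (x ++ q))
      (fun _ _ h => (Produces.append_right h q).append_left p) _ _ hw
  exact ⟨p ++ (w ++ q), hv.trans hpq, by simp [hc]⟩

lemma Yields.exists_rule {a b : Symbol T G.NT} (h : G.Yields b a) :
    ∃ r ∈ G.rules, Symbol.nonterminal r.input = a := by
  obtain ⟨v, hv, -⟩ := h
  obtain ⟨w, ⟨r, hr, hrw⟩, -⟩ := Relation.TransGen.head'_iff.mp hv
  exact ⟨r, hr, by simpa using hrw.nonterminal_input_mem⟩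

lemma wellFounded_yields (hirr : ∀ a, ¬ G.Yields a a) : WellFounded G.Yields := by
  classical
  let below (a : Symbol T G.NT) : Finset (Symbol T G.NT) :=
    (G.rules.image fun r => Symbol.nonterminal r.input).filter fun c => c = a ∨ G.Yields c a
  refine Subrelation.wf (r := InvImage (· < ·) fun a => (below a).card) ?_
    (InvImage.wf _ wellFounded_lt)
  intro b a hba
  refine Finset.card_lt_card ((Finset.ssubset_iff_of_subset ?_).mpr ⟨a, ?_, ?_⟩)
  · intro c hc
    obtain ⟨hc, hcb⟩ := Finset.mem_filter.mp hc
    refine Finset.mem_filter.mpr ⟨hc, Or.inr ?_⟩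
    rcases hcb with rfl | hcb
    · exact hba
    · exact hcb.trans hba
  · exact Finset.mem_filter.mpr ⟨Finset.mem_image.mpr hba.exists_rule, Or.inl rfl⟩
  · intro ha
    rcases (Finset.mem_filter.mp ha).2 with rfl | hab
    · exact hirr _ hba
    · exact hirr _ (hab.trans hba)

lemma Produces.cutExpand {u v : List (Symbol T G.NT)} (h : G.Produces u v) :
    Relation.CutExpand G.Yields (v : Multiset (Symbol T G.NT)) u := by
  obtain ⟨r, hr, hrw⟩ := h
  obtain ⟨p, q, rfl, rfl⟩ := hrw.exists_parts
  refine ⟨r.output, Symbol.nonterminal r.input, fun b hb => ⟨r.output, .single ⟨r, hr, ?_⟩, hb⟩, ?_⟩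
  · exact ContextFreeRule.Rewrites.input_output
  · simp only [← Multiset.coe_add, Multiset.coe_singleton]
    abel

end ContextFreeGrammar

/-- If a context-free grammar `G` is non-recursive, then the one-step derivation relation of `G`
admits no cycle on sentential forms. -/
theorem nonrecursive_no_cycle {T : Type*} (G : ContextFreeGrammar T)
    (hnr : ∀ A : G.NT, ∀ u : List (Symbol T G.NT),
      Relation.TransGen G.Produces [Symbol.nonterminal A] u → Symbol.nonterminal A ∉ u) :
    ∀ u : List (Symbol T G.NT), ¬ Relation.TransGen G.Produces u u := by
  intro u hu
  have hwf : WellFounded G.Yields := by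
    refine ContextFreeGrammar.wellFounded_yields fun a ha => ?_
    obtain ⟨r, -, rfl⟩ := ha.exists_rule
    obtain ⟨v, hv, hmem⟩ := ha
    exact hnr _ v hv hmem
  have hprod : WellFounded (Function.swap G.Produces) :=
    Subrelation.wf (fun h => ContextFreeGrammar.Produces.cutExpand h)
      (InvImage.wf (fun w : List (Symbol T G.NT) => (w : Multiset (Symbol T G.NT)))
        hwf.cutExpand)
  exact hprod.transGen.irrefl.irrefl u hu.swap
end

section
/- Let G be a context-free grammar over a type T of terminals in which every nonterminal is the left-hand side (input) of at most one production rule. Then the language of G contains at most one word: for all s, t ∈ G.language, s = t. -/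
/-- Two rewriting steps from the same string, by rules that coincide as soon as their inputs do,
either agree or commute. -/
theorem ContextFreeRule.Rewrites.eq_or_commute {T N : Type*} {r₁ r₂ : ContextFreeRule T N}
    (hdet : r₁.input = r₂.input → r₁ = r₂) {u v w : List (Symbol T N)}
    (hv : r₁.Rewrites u v) (hw : r₂.Rewrites u w) :
    v = w ∨ ∃ z, r₂.Rewrites v z ∧ r₁.Rewrites w z := by
  induction hv generalizing w with
  | head s =>
    generalize hu : Symbol.nonterminal r₁.input :: s = u at hw
    cases hw with
    | head s' =>
      simp only [List.cons.injEq, Symbol.nonterminal.injEq] at hu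
      left
      rw [hdet hu.1, hu.2]
    | cons x h =>
      obtain ⟨rfl, rfl⟩ := List.cons.inj hu
      exact .inr ⟨_, h.append_left _, .head _⟩
  | cons x h ih =>
    cases hw with
    | head s => exact .inr ⟨_, .head _, h.append_left _⟩
    | cons _ h' =>
      rcases ih h' with rfl | ⟨z, hz₁, hz₂⟩
      · exact .inl rfl
      · exact .inr ⟨_, hz₁.cons x, hz₂.cons x⟩

/-- A string of terminals derives only itself. -/
theorem ContextFreeGrammar.Derives.eq_of_map_terminal {T : Type*} {G : ContextFreeGrammar T}
    {w : List T} {v : List (Symbol T G.NT)} (h : G.Derives (w.map Symbol.terminal) v) :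
    v = w.map Symbol.terminal := by
  rcases h.eq_or_head with h | ⟨_, h, _⟩
  · exact h.symm
  · obtain ⟨r, _, hr⟩ := h.exists_nonterminal_input_mem
    simp at hr

/-- If every nonterminal of a context-free grammar `G` is the left-hand side of at most one
production rule, then `G` generates at most one word. -/
theorem deterministic_language_subsingleton {T : Type*} (G : ContextFreeGrammar T)
    (hdet : ∀ r₁ ∈ G.rules, ∀ r₂ ∈ G.rules, r₁.input = r₂.input → r₁ = r₂) :
    ∀ s ∈ G.language, ∀ t ∈ G.language, s = t := by
  intro s hs t ht
  obtain ⟨z, hsz, htz⟩ := Relation.church_rosser (r := G.Produces) (by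
    rintro u v w ⟨r₁, h₁, hv⟩ ⟨r₂, h₂, hw⟩
    rcases hv.eq_or_commute (hdet r₁ h₁ r₂ h₂) hw with rfl | ⟨z, hvz, hwz⟩
    · exact ⟨v, .refl, .refl⟩
    · exact ⟨z, .single ⟨r₂, h₂, hvz⟩, .single ⟨r₁, h₁, hwz⟩⟩) hs ht
  have hinj : Function.Injective (Symbol.terminal : T → Symbol T G.NT) :=
    fun _ _ h ↦ Symbol.terminal.inj h
  exact hinj.list_map
    ((ContextFreeGrammar.Derives.eq_of_map_terminal hsz).symm.trans
      (ContextFreeGrammar.Derives.eq_of_map_terminal htz))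
end

section
/- Let T be a type, s : List T, and w : List T with |w| ≥ 2. Suppose w has r ≥ 2 pairwise non-overlapping occurrences in s, i.e., there are indices i₁ < i₂ < … < i_r with i_{j+1} ≥ i_j + |w| for all j, i_r + |w| ≤ |s|, and the sublist of s at positions [i_j, i_j + |w|) equals w for each j. Then there exists a context-free grammar G over T with nonterminal type Fin 2 and exactly two production rules such that G.language = {s} and the size of G, defined as the sum over its rules of (length of the right-hand side + 1), equals |s| + 1 − ((|w| − 1)·(r − 1) − 2). (This is the gain formula f(w,G) = (|w|−1)(occ_G(w)−1) − 2 for replacing an exact repeat, relative to the trivial one-rule grammar of size |s| + 1.) -/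
/-- The word obtained from a symbol by replacing each nonterminal `n` by the word `f n`. -/
def Symbol.expand {T N : Type*} (f : N → List T) : Symbol T N → List T
  | .terminal t => [t]
  | .nonterminal n => f n

lemma List.flatMap_expand_map_terminal {T N : Type*} (f : N → List T) (v : List T) :
    (v.map Symbol.terminal).flatMap (Symbol.expand f) = v := by
  induction v with
  | nil => rfl
  | cons a v ih => simp [Symbol.expand, ih]

lemma ContextFreeGrammar.Derives.flatMap_expand_eq {T : Type*} {g : ContextFreeGrammar T}
    (f : g.NT → List T) (hf : ∀ r ∈ g.rules, r.output.flatMap (Symbol.expand f) = f r.input)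
    {u v : List (Symbol T g.NT)} (h : g.Derives u v) :
    u.flatMap (Symbol.expand f) = v.flatMap (Symbol.expand f) := by
  induction h with
  | refl => rfl
  | tail _ hp ih =>
    obtain ⟨r, hr, hrw⟩ := hp
    obtain ⟨p, q, rfl, rfl⟩ := hrw.exists_parts
    rw [ih]
    simp [hf r hr, Symbol.expand]

lemma ContextFreeGrammar.derives_flatMap_expand {T : Type*} {g : ContextFreeGrammar T}
    (f : g.NT → List T) (u : List (Symbol T g.NT))
    (hf : ∀ n, Symbol.nonterminal n ∈ u →
      g.Derives [Symbol.nonterminal n] ((f n).map Symbol.terminal)) :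
    g.Derives u ((u.flatMap (Symbol.expand f)).map Symbol.terminal) := by
  induction u with
  | nil => exact .refl _
  | cons x u ih =>
    have hu := ih fun n hn => hf n (List.mem_cons_of_mem _ hn)
    have hx : g.Derives [x] ((Symbol.expand f x).map Symbol.terminal) := by
      cases x with
      | terminal t => exact .refl _
      | nonterminal n => exact hf n List.mem_cons_self
    rw [List.flatMap_cons, List.map_append]
    exact (hx.append_right u).trans (hu.append_left _)

/-- Non-overlapping occurrences of `w` in `s` can be replaced by the nonterminal `n`. -/
lemma exists_flatMap_expand_eq_of_occurrences {T N : Type*} (n : N) (w : List T)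
    (f : N → List T) (hf : f n = w) (r : ℕ) (s : List T) (i : Fin r → ℕ)
    (hsep : ∀ j₁ j₂ : Fin r, j₁ < j₂ → i j₁ + w.length ≤ i j₂)
    (hbound : ∀ j : Fin r, i j + w.length ≤ s.length)
    (hocc : ∀ j : Fin r, (s.drop (i j)).take w.length = w) :
    ∃ u : List (Symbol T N), (∀ m, Symbol.nonterminal m ∈ u → m = n) ∧
      u.flatMap (Symbol.expand f) = s ∧ u.length + r * w.length = s.length + r := by
  induction r generalizing s with
  | zero => exact ⟨s.map .terminal, by simp, List.flatMap_expand_map_terminal f s, by simp⟩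
  | succ r ih =>
    have hlt (j : Fin r) : i 0 + w.length ≤ i j.succ := hsep 0 j.succ (Fin.succ_pos j)
    obtain ⟨u, hu, hus, hlen⟩ := ih (s.drop (i 0 + w.length))
      (fun j => i j.succ - (i 0 + w.length))
      (fun j₁ j₂ hj => by
        have := hsep j₁.succ j₂.succ (Fin.succ_lt_succ_iff.2 hj)
        have := hlt j₁
        omega)
      (fun j => by
        have := hbound j.succ
        have := hlt j
        rw [List.length_drop]
        omega)
      (fun j => by
        rw [List.drop_drop, Nat.add_sub_cancel' (hlt j)]
        exact hocc j.succ)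
    refine ⟨(s.take (i 0)).map .terminal ++ .nonterminal n :: u, ?_, ?_, ?_⟩
    · intro m hm
      simp only [List.mem_append, List.mem_map, reduceCtorEq, and_false, exists_false,
        List.mem_cons, Symbol.nonterminal.injEq, false_or] at hm
      exact hm.elim id (hu m)
    · rw [List.flatMap_append, List.flatMap_expand_map_terminal, List.flatMap_cons, hus,
        Symbol.expand, hf]
      conv_lhs => enter [2, 1]; rw [← hocc 0]
      rw [← List.drop_drop, List.take_append_drop, List.take_append_drop]
    · have := hbound 0
      rw [List.length_drop] at hlen
      simp only [List.length_append, List.length_map, List.length_take, List.length_cons]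
      rw [Nat.succ_mul]
      omega


/-- Replacing `r ≥ 2` non-overlapping occurrences of an exact repeat `w` (of length `≥ 2`) in `s`
by a fresh nonterminal yields a two-rule grammar generating exactly `s` whose size equals
`|s| + 1 - ((|w| - 1)·(r - 1) - 2)`, i.e. the gain formula for exact repeats. -/
theorem exact_repeat_gain {T : Type*} (s w : List T) (r : ℕ)
    (hw : 2 ≤ w.length) (hr : 2 ≤ r)
    (i : Fin r → ℕ) (hstrict : StrictMono i)
    (hsep : ∀ j₁ j₂ : Fin r, j₁ < j₂ → i j₁ + w.length ≤ i j₂)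
    (hbound : ∀ j : Fin r, i j + w.length ≤ s.length)
    (hocc : ∀ j : Fin r, (s.drop (i j)).take w.length = w) :
    ∃ (init : Fin 2) (rules : Finset (ContextFreeRule T (Fin 2))),
      rules.card = 2 ∧
      (ContextFreeGrammar.mk (Fin 2) init rules).language = {s} ∧
      ((∑ rl ∈ rules, (rl.output.length + 1) : ℕ) : ℤ) =
        (s.length : ℤ) + 1 - (((w.length : ℤ) - 1) * ((r : ℤ) - 1) - 2) := by
  classical
  obtain ⟨u, hu, hus, hlen⟩ := exists_flatMap_expand_eq_of_occurrences (1 : Fin 2) w ![s, w] rfl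
    r s i hsep hbound hocc
  let r₀ : ContextFreeRule T (Fin 2) := ⟨0, u⟩
  let r₁ : ContextFreeRule T (Fin 2) := ⟨1, w.map .terminal⟩
  have hne : r₀ ≠ r₁ := fun h => zero_ne_one (congrArg ContextFreeRule.input h)
  refine ⟨0, {r₀, r₁}, Finset.card_pair hne, ?_, ?_⟩
  · let g : ContextFreeGrammar T := ⟨Fin 2, 0, {r₀, r₁}⟩
    have hw₁ : g.Derives [.nonterminal (1 : Fin 2)] (w.map .terminal) :=
      ContextFreeGrammar.Produces.single
        ⟨r₁, Finset.mem_insert_of_mem (Finset.mem_singleton_self r₁), .input_output⟩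
    have hu₀ : g.Derives [.nonterminal (0 : Fin 2)] u :=
      ContextFreeGrammar.Produces.single
        ⟨r₀, Finset.mem_insert_self r₀ {r₁}, .input_output⟩
    have hus' : g.Derives u (s.map .terminal) := by
      have h := g.derives_flatMap_expand ![s, w] u fun n hn => by
        obtain rfl := hu n hn
        exact hw₁
      rwa [hus] at h
    change g.language = {s}
    ext v
    rw [ContextFreeGrammar.mem_language_iff]
    constructor
    · intro hv
      have h := hv.flatMap_expand_eq ![s, w] fun rl hrl => by
        rcases Finset.mem_insert.1 hrl with rfl | hrl
        · exact hus
        · obtain rfl := Finset.mem_singleton.1 hrl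
          exact List.flatMap_expand_map_terminal _ w
      rw [List.flatMap_expand_map_terminal, List.flatMap_singleton] at h
      exact h.symm
    · rintro rfl
      exact hu₀.trans hus'
  · rw [Finset.sum_pair hne]
    have h : (u.length : ℤ) + r * w.length = s.length + r := by exact_mod_cast hlen
    simp only [r₀, r₁, List.length_map]
    push_cast
    linear_combination h
end
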